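/- arXiv:2503.03241 — 2 statements merged into one kernel-verified Lean document; each statement's English description precedes it below -/
import Mathlib

section
/- Let G and y be discrete random variables with finite range on a common probability space, let G* = g(G) be a deterministic function of G, and let f be a deterministic encoder. Then I(f(G*); G) ≤ I(f(G*); y) + I(G*; G | y). -/
open MeasureTheory

variable {Ω : Type*} [MeasurableSpace Ω]

/-- `probOf μ X x` is the probability `P(X = x)`. -/
noncomputable def probOf (μ : Measure Ω) {S : Type*} (X : Ω → S) (x : S) : ℝ :=
  (μ (X ⁻¹' {x})).toReal

/-- `jointProb μ X Y x y` is the joint probability `P(X = x, Y = y)`. -/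
noncomputable def jointProb (μ : Measure Ω) {S T : Type*} (X : Ω → S) (Y : Ω → T)
    (x : S) (y : T) : ℝ :=
  (μ (X ⁻¹' {x} ∩ Y ⁻¹' {y})).toReal

/-- Shannon entropy `H(X) = -∑ₓ P(X=x) log P(X=x)` of a finite-range random variable. -/
noncomputable def entropy (μ : Measure Ω) {S : Type*} [Fintype S] (X : Ω → S) : ℝ :=
  -∑ x, probOf μ X x * Real.log (probOf μ X x)

/-- Conditional Shannon entropy `H(X|Y) = ∑_y P(Y=y) · H(X | Y = y)`, where
`H(X | Y = y) = -∑ₓ P(X=x | Y=y) log P(X=x | Y=y)` and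
`P(X=x | Y=y) = P(X=x, Y=y) / P(Y=y)` (with the junk convention `·/0 = 0`,
whose contribution is anyway weighted by `P(Y=y) = 0`). -/
noncomputable def condEntropy (μ : Measure Ω) {S T : Type*} [Fintype S] [Fintype T]
    (X : Ω → S) (Y : Ω → T) : ℝ :=
  ∑ y, probOf μ Y y *
    (-∑ x, (jointProb μ X Y x y / probOf μ Y y) *
      Real.log (jointProb μ X Y x y / probOf μ Y y))

/-- Mutual information `I(X;Y) = H(X) - H(X|Y)`. -/
noncomputable def mutualInfo (μ : Measure Ω) {S T : Type*} [Fintype S] [Fintype T]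
    (X : Ω → S) (Y : Ω → T) : ℝ :=
  entropy μ X - condEntropy μ X Y

/-- Conditional mutual information `I(X;Y|Z) = H(X|Z) - H(X|(Y,Z))`. -/
noncomputable def condMutualInfo (μ : Measure Ω) {S T U : Type*}
    [Fintype S] [Fintype T] [Fintype U]
    (X : Ω → S) (Y : Ω → T) (Z : Ω → U) : ℝ :=
  condEntropy μ X Z - condEntropy μ X (fun ω => (Y ω, Z ω))

theorem condEntropy_comp_self (μ : Measure Ω) {S T : Type*} [Fintype S] [Fintype T]
    (Y : Ω → T) (h : T → S) : condEntropy μ (fun ω => h (Y ω)) Y = 0 := by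
  unfold condEntropy
  refine Finset.sum_eq_zero fun t _ => ?_
  rw [Finset.sum_eq_zero, neg_zero, mul_zero]
  intro x _
  by_cases hx : h t = x
  · have : jointProb μ (fun ω => h (Y ω)) Y x t = probOf μ Y t := by
      unfold jointProb probOf
      congr 2
      ext ω
      simp only [Set.mem_inter_iff, Set.mem_preimage, Set.mem_singleton_iff]
      constructor
      · exact fun a => a.2
      · exact fun a => ⟨by rw [a, hx], a⟩
    rw [this]
    by_cases hp : probOf μ Y t = 0
    · simp [hp]
    · simp [div_self hp]
  · have : jointProb μ (fun ω => h (Y ω)) Y x t = 0 := by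
      unfold jointProb
      have he : (fun ω => h (Y ω)) ⁻¹' {x} ∩ Y ⁻¹' {t} = ∅ := by
        ext ω
        simp only [Set.mem_inter_iff, Set.mem_preimage, Set.mem_singleton_iff,
          Set.mem_empty_iff_false, iff_false]
        rintro ⟨a, b⟩
        exact hx (by rw [← b, a])
      rw [he]
      simp
    simp [this]

open Classical in
theorem jointProb_comp (μ : Measure Ω) [IsProbabilityMeasure μ] {S T U : Type*} [Fintype S]
    (X : Ω → S) (hX : ∀ x, MeasurableSet (X ⁻¹' {x}))
    (Y : Ω → T) (hY : ∀ x, MeasurableSet (Y ⁻¹' {x})) (f : S → U) (u : U) (t : T) :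
    jointProb μ (fun ω => f (X ω)) Y u t
      = ∑ x with f x = u, jointProb μ X Y x t := by
  unfold jointProb
  have he : (fun ω => f (X ω)) ⁻¹' {u} ∩ Y ⁻¹' {t}
      = ⋃ x ∈ Finset.univ.filter (fun x => f x = u), (X ⁻¹' {x} ∩ Y ⁻¹' {t}) := by
    ext ω
    simp
  rw [he, measure_biUnion_finset, ENNReal.toReal_sum]
  · intro a _
    exact measure_ne_top _ _
  · intro a _ b _ hab
    refine Set.disjoint_left.2 ?_
    rintro ω ⟨h1, _⟩ ⟨h2, _⟩
    simp only [Set.mem_preimage, Set.mem_singleton_iff] at h1 h2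
    exact hab (h1.symm.trans h2)
  · intro a _
    exact (hX a).inter (hY t)

theorem condEntropy_comp_le (μ : Measure Ω) [IsProbabilityMeasure μ] {S T U : Type*}
    [Fintype S] [Fintype T] [Fintype U]
    (X : Ω → S) (hX : ∀ x, MeasurableSet (X ⁻¹' {x}))
    (Y : Ω → T) (hY : ∀ x, MeasurableSet (Y ⁻¹' {x})) (f : S → U) :
    condEntropy μ (fun ω => f (X ω)) Y ≤ condEntropy μ X Y := by
  classical
  unfold condEntropy
  refine Finset.sum_le_sum fun t _ => ?_
  have hp : 0 ≤ probOf μ Y t := ENNReal.toReal_nonneg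
  refine mul_le_mul_of_nonneg_left (neg_le_neg ?_) hp
  rw [← Finset.sum_fiberwise (s := Finset.univ) (g := f)]
  refine Finset.sum_le_sum fun u _ => ?_
  have hq : ∀ x, 0 ≤ jointProb μ X Y x t / probOf μ Y t :=
    fun x => div_nonneg ENNReal.toReal_nonneg hp
  rw [jointProb_comp μ X hX Y hY f u t, Finset.sum_div, Finset.sum_mul]
  refine Finset.sum_le_sum fun x hx => ?_
  rcases (hq x).eq_or_lt with h0 | h0
  · simp [← h0]
  · refine mul_le_mul_of_nonneg_left (Real.log_le_log h0 ?_) (hq x)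
    exact Finset.single_le_sum
      (f := fun x => jointProb μ X Y x t / probOf μ Y t) (fun i _ => hq i) hx

/-- **Lemma 2.** For finite-range discrete random variables `G` and `y`, a
deterministic view `G* = g(G)` and a deterministic encoder `f`:
`I(f(G*); G) ≤ I(f(G*); y) + I(G*; G | y)`. -/
theorem mutualInfo_encoded_le_label_add_condMutualInfo
    (μ : Measure Ω) [IsProbabilityMeasure μ]
    {S U L : Type*} [Fintype S] [Fintype U] [Fintype L]
    (G : Ω → S) (hG : ∀ x, MeasurableSet (G ⁻¹' {x}))
    (y : Ω → L) (hy : ∀ l, MeasurableSet (y ⁻¹' {l}))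
    (g : S → S) (f : S → U) :
    mutualInfo μ (fun ω => f (g (G ω))) G ≤
      mutualInfo μ (fun ω => f (g (G ω))) y +
        condMutualInfo μ (fun ω => g (G ω)) G y := by
  have h1 := condEntropy_comp_self μ G (fun s => f (g s))
  have h2 := condEntropy_comp_self μ (fun ω => (G ω, y ω)) (fun p => g p.1)
  have hm : ∀ x, MeasurableSet ((fun ω => g (G ω)) ⁻¹' {x}) := by
    intro x
    have he : (fun ω => g (G ω)) ⁻¹' {x} = ⋃ s ∈ {s | g s = x}, G ⁻¹' {s} := by
      ext ω
      simp
    rw [he]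
    exact MeasurableSet.biUnion (Set.to_countable _) fun s _ => hG s
  have h3 := condEntropy_comp_le μ (fun ω => g (G ω)) hm y hy f
  unfold mutualInfo condMutualInfo
  simp only at h1 h2 h3
  linarith
end

section
/- Let G and y be discrete random variables with finite range on a common probability space, let G* = g(G) be a deterministic function of G, and let f be a deterministic encoder. Then I(f(G*); y) ≥ I(f(G*); f(G)) − I(G*; G | y). In particular, for fixed label-conditional redundancy I(G*; G | y), maximizing the contrastive objective I(f(G*); f(G)) maximizes a lower bound on the label-relevant information I(f(G*); y). -/
open MeasureTheory

variable {Ω : Type*} [MeasurableSpace Ω]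

lemma aux_ratio (μ : Measure Ω) [IsProbabilityMeasure μ] {S T : Type*} (X : Ω → S) (Y : Ω → T)
    (x : S) (t : T) :
    0 ≤ jointProb μ X Y x t / probOf μ Y t ∧ jointProb μ X Y x t / probOf μ Y t ≤ 1 := by
  unfold jointProb probOf
  refine ⟨by positivity, div_le_one_of_le₀ ?_ ENNReal.toReal_nonneg⟩
  exact ENNReal.toReal_mono (measure_ne_top _ _) (measure_mono Set.inter_subset_right)

lemma aux_condEntropy_nonneg (μ : Measure Ω) [IsProbabilityMeasure μ] {S T : Type*} [Fintype S]
    [Fintype T] (X : Ω → S) (Y : Ω → T) : 0 ≤ condEntropy μ X Y := by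
  unfold condEntropy
  refine Finset.sum_nonneg fun t _ => mul_nonneg ENNReal.toReal_nonneg ?_
  rw [neg_nonneg]
  refine Finset.sum_nonpos fun x _ => ?_
  have h := aux_ratio μ X Y x t
  exact mul_nonpos_of_nonneg_of_nonpos h.1 (Real.log_nonpos h.1 h.2)

lemma aux_condEntropy_zero (μ : Measure Ω) {S T V : Type*} [Fintype S]
    [Fintype T] [Fintype V] (G : Ω → S) (y : Ω → T) (g : S → V) :
    condEntropy μ (fun ω => g (G ω)) (fun ω => (G ω, y ω)) = 0 := by
  unfold condEntropy
  refine Finset.sum_eq_zero fun t _ => ?_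
  rw [mul_eq_zero]; right
  rw [neg_eq_zero]
  refine Finset.sum_eq_zero fun x _ => ?_
  by_cases hx : g t.1 = x
  · have : (fun ω => g (G ω)) ⁻¹' {x} ∩ (fun ω => (G ω, y ω)) ⁻¹' {t}
        = (fun ω => (G ω, y ω)) ⁻¹' {t} := by
      apply Set.inter_eq_right.2
      rintro ω hω
      simp only [Set.mem_preimage, Set.mem_singleton_iff] at hω ⊢
      rw [← hx, ← hω]
    unfold jointProb probOf
    rw [this]
    by_cases h0 : (μ ((fun ω => (G ω, y ω)) ⁻¹' {t})).toReal = 0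
    · simp [h0]
    · simp [div_self h0]
  · have : (fun ω => g (G ω)) ⁻¹' {x} ∩ (fun ω => (G ω, y ω)) ⁻¹' {t} = ∅ := by
      ext ω
      simp only [Set.mem_inter_iff, Set.mem_preimage, Set.mem_singleton_iff,
        Set.mem_empty_iff_false, iff_false, not_and]
      intro h1 h2
      apply hx
      rw [← h1, ← h2]
    unfold jointProb
    rw [this]
    simp

open Classical in
lemma aux_joint_sum (μ : Measure Ω) [IsProbabilityMeasure μ] {S T U : Type*} [Fintype S]
    (Z : Ω → S) (hZ : ∀ x, MeasurableSet (Z ⁻¹' {x})) (y : Ω → T)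
    (hy : ∀ l, MeasurableSet (y ⁻¹' {l})) (f : S → U) (u : U) (l : T) :
    jointProb μ (fun ω => f (Z ω)) y u l =
      ∑ z ∈ Finset.univ.filter (fun z => f z = u), jointProb μ Z y z l := by
  unfold jointProb
  rw [← ENNReal.toReal_sum (fun _ _ => measure_ne_top _ _), ← measure_biUnion_finset]
  · congr 2
    ext ω
    simp
  · intro a _ b _ hab
    refine Set.disjoint_left.2 ?_
    rintro ω ⟨h1, _⟩ ⟨h2, _⟩
    exact hab (h1.symm.trans h2)
  · exact fun z _ => (hZ z).inter (hy l)

open Classical in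
lemma aux_condEntropy_comp_le (μ : Measure Ω) [IsProbabilityMeasure μ] {S T U : Type*} [Fintype S]
    [Fintype T] [Fintype U]
    (Z : Ω → S) (hZ : ∀ x, MeasurableSet (Z ⁻¹' {x})) (y : Ω → T)
    (hy : ∀ l, MeasurableSet (y ⁻¹' {l})) (f : S → U) :
    condEntropy μ (fun ω => f (Z ω)) y ≤ condEntropy μ Z y := by
  unfold condEntropy
  refine Finset.sum_le_sum fun l _ => mul_le_mul_of_nonneg_left ?_ ENNReal.toReal_nonneg
  rw [neg_le_neg_iff]
  set q : S → ℝ := fun z => jointProb μ Z y z l / probOf μ y l with hq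
  have hq0 : ∀ z, 0 ≤ q z := fun z => (aux_ratio μ Z y z l).1
  have hs : ∀ u, jointProb μ (fun ω => f (Z ω)) y u l / probOf μ y l
      = ∑ z ∈ Finset.univ.filter (fun z => f z = u), q z := by
    intro u
    rw [aux_joint_sum μ Z hZ y hy f u l, Finset.sum_div]
  simp only [hs]
  rw [← Finset.sum_fiberwise (s := Finset.univ) (g := f)]
  refine Finset.sum_le_sum fun u _ => ?_
  rw [Finset.sum_mul]
  refine Finset.sum_le_sum fun z hz => ?_
  rcases (hq0 z).eq_or_lt with h | h
  · change q z * Real.log (q z) ≤ _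
    rw [← h]; simp
  · refine mul_le_mul_of_nonneg_left (Real.log_le_log h ?_) h.le
    exact Finset.single_le_sum (f := q) (fun i _ => hq0 i) hz

/-- **Theorem 2.** For finite-range discrete random variables `G` and `y`, a
deterministic view `G* = g(G)` and a deterministic encoder `f`:
`I(f(G*); y) ≥ I(f(G*); f(G)) − I(G*; G | y)`; hence, for fixed label-conditional
redundancy `I(G*; G | y)`, maximizing the contrastive objective `I(f(G*); f(G))`
maximizes a lower bound on the label-relevant information `I(f(G*); y)`. -/
theorem mutualInfo_label_ge_contrastive_sub_condMutualInfo
    (μ : Measure Ω) [IsProbabilityMeasure μ]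
    {S U L : Type*} [Fintype S] [Fintype U] [Fintype L]
    (G : Ω → S) (hG : ∀ x, MeasurableSet (G ⁻¹' {x}))
    (y : Ω → L) (hy : ∀ l, MeasurableSet (y ⁻¹' {l}))
    (g : S → S) (f : S → U) :
    mutualInfo μ (fun ω => f (g (G ω))) y ≥
      mutualInfo μ (fun ω => f (g (G ω))) (fun ω => f (G ω)) -
        condMutualInfo μ (fun ω => g (G ω)) G y := by
  have hZ : ∀ x, MeasurableSet ((fun ω => g (G ω)) ⁻¹' {x}) := by
    intro x
    have : (fun ω => g (G ω)) ⁻¹' {x} = ⋃ s ∈ {s | g s = x}, G ⁻¹' {s} := by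
      ext ω
      simp
    rw [this]
    exact MeasurableSet.biUnion (Set.to_countable _) fun s _ => hG s
  have h1 := aux_condEntropy_comp_le μ (fun ω => g (G ω)) hZ y hy f
  have h2 := aux_condEntropy_zero μ G y g
  have h3 := aux_condEntropy_nonneg μ (fun ω => f (g (G ω))) (fun ω => f (G ω))
  unfold mutualInfo condMutualInfo
  linarith
end
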